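/- Let m be a positive integer or half-integer (2m ∈ ℕ) and s ∈ ℤ + 1/2. Let τ lie in the upper half-plane and z₁, z₂ ∈ ℂ with z₁ ∉ ℤ + ℤτ. Set f_{j,k} := (−1)^j q^{(m+1/2)(j+s/(2m+1))² − k²/(4m)} e^{−2πijm(z₁−z₂)+πik(z₁−z₂)}. Then θ^{(−)}_{s,m+1/2}(τ, −2m(z₁−z₂)/(2m+1)) · Φ₁^{[m,0]}(τ, z₁, z₂) + e^{−2πims(z₁−z₂)/(2m+1)} ∑_{r=0}^{2m−1} (∑_{j,p∈ℤ, 0<p≤j} − ∑_{j,p∈ℤ, j<p≤0}) f_{−j, r−2pm} θ_{r,m}(τ, z₁+z₂) = −i θ^{(−)}_{s,m+1/2}(τ, z₁+z₂+(z₁−z₂)/(2m+1)) · η(τ)³ / ϑ₁₁(τ, z₁). -/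

import Mathlib

noncomputable section

open Complex

/-- `e2 w = exp (2 π i w)`; with `q = e^{2πiτ}`, the power `q^x` corresponds to `e2 (x * τ)`. -/
def e2 (w : ℂ) : ℂ := Complex.exp (2 * (Real.pi : ℂ) * Complex.I * w)

/-- Jacobi-type theta function `θ^{(ε)}_{n,m}(τ, z) = ∑_{j∈ℤ} ε^j q^{m(j+n/(2m))²} e^{2πim(j+n/(2m))z}`. -/
def jtheta (ε n m τ z : ℂ) : ℂ :=
  ∑' j : ℤ, ε ^ j *
    e2 (m * ((j : ℂ) + n / (2 * m)) ^ 2 * τ + m * ((j : ℂ) + n / (2 * m)) * z)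

/-- Mock theta function `Φ₁^{(ε)[m,s]}(τ, z₁, z₂)`. -/
def Phi1 (ε m s τ z₁ z₂ : ℂ) : ℂ :=
  ∑' j : ℤ, ε ^ j *
    e2 (m * (j : ℂ) * (z₁ + z₂) + s * z₁ + (m * (j : ℂ) ^ 2 + s * (j : ℂ)) * τ) /
      (1 - e2 (z₁ + (j : ℂ) * τ))

/-- Dedekind eta function `η(τ) = q^{1/24} ∏_{k≥1} (1 - q^k)`. -/
def dedekindEta (τ : ℂ) : ℂ := e2 (τ / 24) * ∏' k : ℕ, (1 - e2 (((k : ℂ) + 1) * τ))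

/-- Jacobi theta `ϑ₁₁(τ, z) = i ∑_{j∈ℤ} (−1)^j q^{(j+1/2)²/2} e^{2πi(j+1/2)z}`. -/
def theta11 (τ z : ℂ) : ℂ :=
  Complex.I * ∑' j : ℤ, (-1 : ℂ) ^ j *
    e2 (((j : ℂ) + 1 / 2) ^ 2 / 2 * τ + ((j : ℂ) + 1 / 2) * z)

/-- Indefinite double sum `(∑_{j,p∈ℤ, 0<p≤j} − ∑_{j,p∈ℤ, j<p≤0}) f j p`. -/
def indefSum (f : ℤ → ℤ → ℂ) : ℂ :=
  ∑' jp : ℤ × ℤ,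
    ((if 0 < jp.2 ∧ jp.2 ≤ jp.1 then f jp.1 jp.2 else 0) -
      (if jp.1 < jp.2 ∧ jp.2 ≤ 0 then f jp.1 jp.2 else 0))

/-- `g^{[m]}_{n,ν}(τ)`. -/
def gfun (m : ℂ) (n ν : ℤ) (τ : ℂ) : ℂ :=
  indefSum fun j p =>
    (-1 : ℂ) ^ j *
      e2 (((m + 1 / 2) * ((j : ℂ) + (ν : ℂ) - ((ν : ℂ) + 1 / 2) / (2 * m + 1)) ^ 2 -
        m * ((p : ℂ) + (ν : ℂ) - (n : ℂ) / (2 * m)) ^ 2) * τ)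

/-- `h^{[m]}_{n,ν}(τ, z)`. -/
def hfun (m : ℂ) (n ν : ℤ) (τ z : ℂ) : ℂ :=
  ∑' j : ℤ,
    e2 (m * (j : ℂ) * z + (n : ℂ) * z / 2 +
        (m * (j : ℂ) ^ 2 + (n : ℂ) * ((j : ℂ) + (ν : ℂ))) * τ) /
      (1 - e2 (m * z + 2 * m * ((j : ℂ) + (ν : ℂ)) * τ))

/-- `G^{[m]}_{n,ν}(τ, z)`. -/
def Gfun (m : ℂ) (n ν : ℤ) (τ z : ℂ) : ℂ :=
  gfun m n ν τ * jtheta 1 (n : ℂ) m τ z +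
    (-1 : ℂ) ^ ν * e2 (-(m * (ν : ℂ) ^ 2) * τ) *
      jtheta (-1) ((ν : ℂ) + 1 / 2) (m + 1 / 2) τ 0 * hfun m n ν τ z

/-- `F^{[m](a,b)}_{n,ν}(τ, z)`. -/
def Ffun (m : ℂ) (a b n ν : ℤ) (τ z : ℂ) : ℂ :=
  e2 ((a : ℂ) * z / 2 + (a : ℂ) ^ 2 / (4 * m) * τ) *
    Gfun m n ν τ (z + (a : ℂ) * τ / m + (b : ℂ) / m)

/-- The coefficient `f_{j,k}` of Lemma 3.1:
`f_{j,k} = (−1)^j q^{(m+1/2)(j+s/(2m+1))² − k²/(4m)} e^{−2πijm(z₁−z₂)+πik(z₁−z₂)}`. -/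
def fcoef (m s τ z₁ z₂ : ℂ) (j k : ℤ) : ℂ :=
  (-1 : ℂ) ^ j *
    e2 (((m + 1 / 2) * ((j : ℂ) + s / (2 * m + 1)) ^ 2 - (k : ℂ) ^ 2 / (4 * m)) * τ +
      (-((j : ℂ) * m) + (k : ℂ) / 2) * (z₁ - z₂))


theorem e2_add (a b : ℂ) : e2 (a + b) = e2 a * e2 b := by
  unfold e2; rw [← Complex.exp_add]; congr 1; ring

theorem e2_zero : e2 0 = 1 := by simp [e2]

theorem e2_ne (a : ℂ) : e2 a ≠ 0 := Complex.exp_ne_zero _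

theorem e2_neg (a : ℂ) : e2 (-a) = (e2 a)⁻¹ := by
  unfold e2; rw [← Complex.exp_neg]; congr 1; ring

theorem e2_nat (n : ℕ) (a : ℂ) : e2 (n * a) = e2 a ^ n := by
  unfold e2; rw [← Complex.exp_nat_mul]; congr 1; ring

theorem e2_int (n : ℤ) (a : ℂ) : e2 (n * a) = e2 a ^ n := by
  unfold e2; rw [← Complex.exp_int_mul]; congr 1; ring

theorem norm_e2 (a : ℂ) : ‖e2 a‖ = Real.exp (-(2 * Real.pi * a.im)) := by
  unfold e2; rw [Complex.norm_exp]; congr 1; simp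

theorem norm_e2_le {a b : ℂ} (h : a.im ≤ b.im) : ‖e2 b‖ ≤ ‖e2 a‖ := by
  rw [norm_e2, norm_e2, Real.exp_le_exp]
  have := Real.pi_pos
  nlinarith

theorem norm_e2_lt_one {τ : ℂ} (hτ : 0 < τ.im) : ‖e2 τ‖ < 1 := by
  rw [norm_e2, Real.exp_lt_one_iff]
  have := Real.pi_pos
  nlinarith [mul_pos Real.pi_pos hτ]

theorem e2_one_sub_ne {z τ : ℂ} (hz : ∀ a b : ℤ, z ≠ (a : ℂ) + (b : ℂ) * τ) (j : ℤ) :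
    1 - e2 (z + j * τ) ≠ 0 := by
  intro h
  have h1 : e2 (z + j * τ) = 1 := by linear_combination -h
  unfold e2 at h1
  rw [Complex.exp_eq_one_iff] at h1
  obtain ⟨n, hn⟩ := h1
  have h2 : z + j * τ = n := by
    have h3 : (2 * (Real.pi : ℂ) * Complex.I) ≠ 0 := Complex.two_pi_I_ne_zero
    apply mul_left_cancel₀ h3
    rw [hn]; ring
  apply hz n (-j)
  push_cast
  linear_combination h2

theorem summable_gauss {A : ℂ} (hA : 0 < A.im) (B C : ℂ) :
    Summable fun j : ℤ => ‖e2 (A * (j : ℂ) ^ 2 + B * j + C)‖ := by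
  have h := ((summable_jacobiTheta₂_term_iff B (2 * A)).2 (by simpa using hA)).norm.mul_left ‖e2 C‖
  refine h.congr fun j => ?_
  rw [← norm_mul]
  congr 1
  unfold e2 jacobiTheta₂_term
  rw [← Complex.exp_add]; congr 1; ring

theorem norm_neg_one_zpow (j : ℤ) : ‖(-1 : ℂ) ^ j‖ = 1 := by
  rw [norm_zpow]; simp

/-- `1/(1-x q^j)` is bounded. -/
theorem bdd_inv {z τ : ℂ} (hτ : 0 < τ.im) :
    ∃ C : ℝ, 0 ≤ C ∧ ∀ j : ℤ, ‖(1 - e2 (z + j * τ))⁻¹‖ ≤ C := by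
  have hq : Filter.Tendsto (fun n : ℕ => e2 τ ^ n) Filter.atTop (nhds 0) :=
    tendsto_pow_atTop_nhds_zero_of_norm_lt_one (norm_e2_lt_one hτ)
  have h1 : Filter.Tendsto (fun n : ℕ => ‖(1 - e2 z * e2 τ ^ n)⁻¹‖) Filter.atTop
      (nhds ‖((1 : ℂ) - e2 z * 0)⁻¹‖) :=
    ((tendsto_const_nhds.sub (tendsto_const_nhds.mul hq)).inv₀ (by simp)).norm
  have h2 : Filter.Tendsto (fun n : ℕ => ‖e2 τ ^ n * (e2 τ ^ n - e2 z)⁻¹‖) Filter.atTop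
      (nhds ‖(0 : ℂ) * (0 - e2 z)⁻¹‖) :=
    (hq.mul ((hq.sub tendsto_const_nhds).inv₀ (by simpa using e2_ne z))).norm
  obtain ⟨C1, hC1⟩ := h1.bddAbove_range
  obtain ⟨C2, hC2⟩ := h2.bddAbove_range
  refine ⟨max C1 C2, ?_, ?_⟩
  · exact le_trans (norm_nonneg _) (le_trans (hC1 ⟨0, rfl⟩) (le_max_left _ _))
  intro j
  obtain ⟨n, rfl | rfl⟩ := j.eq_nat_or_neg
  · refine le_trans (le_of_eq ?_) (le_trans (hC1 ⟨n, rfl⟩) (le_max_left _ _))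
    simp only [Int.cast_natCast, e2_add, e2_nat]
  · refine le_trans (le_of_eq ?_) (le_trans (hC2 ⟨n, rfl⟩) (le_max_right _ _))
    have hne : e2 τ ^ n ≠ 0 := pow_ne_zero _ (e2_ne τ)
    simp only [Int.cast_neg, Int.cast_natCast, e2_add, neg_mul, e2_neg, e2_nat]
    congr 1
    by_cases h : e2 τ ^ n - e2 z = 0
    · have : e2 z = e2 τ ^ n := by linear_combination -h
      rw [this]; simp [hne]
    · have h' : 1 - e2 z * (e2 τ ^ n)⁻¹ = (e2 τ ^ n - e2 z) * (e2 τ ^ n)⁻¹ := by field_simp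
      rw [h', mul_inv, inv_inv, mul_comm]

/-- inverse q-factorial -/
def rq (τ : ℂ) (n : ℤ) : ℂ :=
  if n < 0 then 0 else (∏ i ∈ Finset.range n.toNat, (1 - e2 (((i : ℂ) + 1) * τ)))⁻¹

theorem one_sub_q_ne {τ : ℂ} (hτ : 0 < τ.im) (i : ℕ) : 1 - e2 (((i : ℂ) + 1) * τ) ≠ 0 := by
  intro h
  have h1 : e2 (((i : ℂ) + 1) * τ) = 1 := by linear_combination -h
  have h2 : ‖e2 (((i : ℂ) + 1) * τ)‖ < 1 := by
    apply norm_e2_lt_one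
    have : (((i : ℂ) + 1) * τ).im = ((i : ℝ) + 1) * τ.im := by simp
    rw [this]; positivity
  rw [h1] at h2; simp at h2

theorem rq_rec {τ : ℂ} (hτ : 0 < τ.im) (n : ℤ) : rq τ (n - 1) = (1 - e2 (n * τ)) * rq τ n := by
  unfold rq
  rcases lt_trichotomy n 0 with h | h | h
  · rw [if_pos h, if_pos (by omega)]; simp
  · subst h; simp [e2_zero]
  · obtain ⟨k, rfl⟩ : ∃ k : ℕ, n = k + 1 := ⟨(n - 1).toNat, by omega⟩
    rw [if_neg (by omega), if_neg (by omega)]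
    have e1 : ((k : ℤ) + 1 - 1).toNat = k := by omega
    have e3 : ((k : ℤ) + 1).toNat = k + 1 := by omega
    rw [e1, e3, Finset.prod_range_succ, mul_inv]
    have := one_sub_q_ne hτ k
    push_cast
    rw [mul_comm, mul_assoc, inv_mul_cancel₀ this, mul_one]

theorem summable_q {τ : ℂ} (hτ : 0 < τ.im) : Summable fun i : ℕ => ‖-e2 (((i : ℂ) + 1) * τ)‖ := by
  have h := (summable_geometric_of_norm_lt_one (norm_e2_lt_one hτ)).norm.mul_left ‖e2 τ‖
  refine h.congr fun i => ?_
  rw [← norm_mul, norm_neg, add_mul, one_mul, e2_add, e2_nat, mul_comm]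

/-- Euler product -/
def eulq (τ : ℂ) : ℂ := ∏' k : ℕ, (1 - e2 (((k : ℂ) + 1) * τ))

theorem eulq_ne {τ : ℂ} (hτ : 0 < τ.im) : eulq τ ≠ 0 := by
  have := tprod_one_add_ne_zero_of_summable (f := fun i : ℕ => -e2 (((i : ℂ) + 1) * τ))
    (fun i => by have := one_sub_q_ne hτ i; rwa [← sub_eq_add_neg]) (summable_q hτ)
  simpa [eulq, sub_eq_add_neg] using this

theorem rq_tendsto {τ : ℂ} (hτ : 0 < τ.im) :
    Filter.Tendsto (rq τ) Filter.atTop (nhds (eulq τ)⁻¹) := by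
  have hm : Multipliable fun i : ℕ => 1 + -e2 (((i : ℂ) + 1) * τ) :=
    multipliable_one_add_of_summable (summable_q hτ)
  have h := hm.hasProd.tendsto_prod_nat
  have hT : Filter.Tendsto Int.toNat Filter.atTop Filter.atTop :=
    Filter.tendsto_atTop.2 fun b => by
      filter_upwards [Filter.eventually_ge_atTop (b : ℤ)] with n hn
      omega
  have h' := (h.comp hT).inv₀ (by simpa [eulq, sub_eq_add_neg] using eulq_ne hτ)
  have : (∏' i : ℕ, (1 + -e2 (((i : ℂ) + 1) * τ))) = eulq τ := by simp [eulq, sub_eq_add_neg]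
  rw [this] at h'
  refine h'.congr' ?_
  filter_upwards [Filter.eventually_ge_atTop 0] with n hn
  simp [rq, not_lt.2 hn, sub_eq_add_neg]

theorem rq_bdd {τ : ℂ} (hτ : 0 < τ.im) : ∃ R : ℝ, 0 ≤ R ∧ ∀ n, ‖rq τ n‖ ≤ R := by
  have h := ((rq_tendsto hτ).comp tendsto_natCast_atTop_atTop).norm
  obtain ⟨R, hR⟩ := h.bddAbove_range
  have h0 : 0 ≤ R := le_trans (norm_nonneg _) (hR ⟨0, rfl⟩)
  refine ⟨R, h0, fun n => ?_⟩
  by_cases hn : n < 0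
  · simp [rq, hn, h0]
  · have := hR ⟨n.toNat, rfl⟩
    simpa [Int.toNat_of_nonneg (not_lt.1 hn)] using this

theorem hasSum_of_eq {f g : ℤ → ℂ} {a b : ℂ} (h : HasSum g b) (hf : f = g) (ha : a = b) :
    HasSum f a := by rw [hf, ha]; exact h

/-- finite triple product -/
def PN (τ z : ℂ) (N : ℕ) : ℂ :=
  ∏ i ∈ Finset.range N, ((1 - e2 (z + i * τ)) * (1 - e2 (((i : ℂ) + 1) * τ - z)))

def cN (τ : ℂ) (N j : ℤ) : ℂ :=
  (-1) ^ j * e2 ((j : ℂ) * (j - 1) / 2 * τ) * rq τ (N - j) * rq τ (N + j)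

theorem cN_rec {τ : ℂ} (hτ : 0 < τ.im) (N j : ℤ) :
    (1 - e2 ((2 * N + 1) * τ)) * (1 - e2 ((2 * N + 2) * τ)) * cN τ (N + 1) j =
      (1 + e2 ((2 * N + 1) * τ)) * cN τ N j - e2 (N * τ) * cN τ N (j - 1)
        - e2 ((N + 1) * τ) * cN τ N (j + 1) := by
  unfold cN
  have a1 := rq_rec hτ (N + 1 - j)
  have a2 := rq_rec hτ (N - j)
  have b1 := rq_rec hτ (N + 1 + j)
  have b2 := rq_rec hτ (N + j)
  rw [show N + 1 - j - 1 = N - j by ring] at a1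
  rw [show N + 1 + j - 1 = N + j by ring] at b1
  rw [show N - (j - 1) = N + 1 - j by ring, show N + (j - 1) = N + j - 1 by ring,
    show N - (j + 1) = N - j - 1 by ring, show N + (j + 1) = N + 1 + j by ring, b2, a2, a1, b1]
  rw [zpow_sub_one₀ (by norm_num), zpow_add_one₀ (by norm_num)]
  push_cast
  have E1 : ((j : ℂ) - 1) * (j - 1 - 1) / 2 * τ = (j : ℂ) * (j - 1) / 2 * τ + -(j * τ) + τ := by ring
  have E2 : ((j : ℂ) + 1) * (j + 1 - 1) / 2 * τ = (j : ℂ) * (j - 1) / 2 * τ + j * τ := by ring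
  rw [E1, E2]
  simp only [e2_add ((j : ℂ) * (j - 1) / 2 * τ + -(j * τ)), e2_add ((j : ℂ) * (j - 1) / 2 * τ)]
  generalize e2 ((j : ℂ) * (j - 1) / 2 * τ) = EE
  simp only [add_mul, two_mul, one_mul, sub_eq_add_neg, neg_mul, e2_add, e2_neg]
  have hJ := e2_ne (j * τ)
  generalize e2 (j * τ) = J at hJ ⊢
  generalize e2 (N * τ) = NN
  generalize e2 τ = Q
  generalize rq τ (N + 1 - j) = R1
  generalize rq τ (N + 1 + j) = R2
  field_simp
  ring

theorem jtp_fin {τ : ℂ} (hτ : 0 < τ.im) (z : ℂ) (N : ℕ) :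
    HasSum (fun j : ℤ => cN τ N j * e2 (j * z)) (PN τ z N * rq τ (2 * N)) := by
  induction N with
  | zero =>
    have := hasSum_single (f := fun j : ℤ => cN τ (0 : ℕ) j * e2 (j * z)) 0 (by
      intro j hj
      have : rq τ (0 - j) * rq τ (0 + j) = 0 := by
        rcases lt_or_gt_of_ne hj with h | h
        · have : rq τ (0 + j) = 0 := by simp [rq, h]
          rw [this, mul_zero]
        · have : rq τ (0 - j) = 0 := by simp [rq, h]
          rw [this, zero_mul]
      simp only [cN, Nat.cast_zero]
      rw [mul_assoc ((-1 : ℂ) ^ j * _), this]; simp)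
    simpa [cN, PN, rq, e2_zero] using this
  | succ N ih =>
    have hA : (1 - e2 ((2 * (N : ℂ) + 1) * τ)) ≠ 0 := by
      simpa using one_sub_q_ne hτ (2 * N)
    have hB : (1 - e2 ((2 * (N : ℂ) + 2) * τ)) ≠ 0 := by
      have := one_sub_q_ne hτ (2 * N + 1)
      push_cast at this
      rwa [show (2 * (N : ℂ) + 1 + 1) = 2 * N + 2 by ring] at this
    have h1 := ih.mul_left (1 + e2 ((2 * (N : ℂ) + 1) * τ))
    have h2 := ((Equiv.subRight (1 : ℤ)).hasSum_iff.2 ih).mul_left (e2 (N * τ) * e2 z)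
    have h3 := ((Equiv.addRight (1 : ℤ)).hasSum_iff.2 ih).mul_left (e2 ((N + 1) * τ) * e2 (-z))
    have h := ((h1.sub h2).sub h3).mul_left
      (((1 - e2 ((2 * (N : ℂ) + 1) * τ)) * (1 - e2 ((2 * (N : ℂ) + 2) * τ)))⁻¹)
    refine hasSum_of_eq h ?_ ?_
    · funext j
      have hr := cN_rec hτ N j
      simp only [Int.cast_natCast] at hr
      simp only [Function.comp, Equiv.subRight_apply, Equiv.coe_addRight]
      rw [eq_inv_mul_iff_mul_eq₀ (mul_ne_zero hA hB)]
      push_cast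
      rw [← mul_assoc, hr]
      simp only [add_mul, one_mul, sub_eq_add_neg, e2_add, e2_neg, neg_mul]
      have hZ := e2_ne z
      generalize e2 z = Z at hZ ⊢
      field_simp
    · rw [eq_inv_mul_iff_mul_eq₀ (mul_ne_zero hA hB)]
      have r1 := rq_rec hτ (2 * N + 1)
      have r2 := rq_rec hτ (2 * N + 2)
      rw [show (2 * (N : ℤ) + 1 - 1) = 2 * N by ring] at r1
      rw [show (2 * (N : ℤ) + 2 - 1) = 2 * N + 1 by ring] at r2
      push_cast at r1 r2 ⊢
      rw [r1, r2, show (2 * ((N : ℤ) + 1)) = 2 * N + 2 by ring]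
      have hP : PN τ z (N + 1) = PN τ z N *
        ((1 - e2 (z + N * τ)) * (1 - e2 (((N : ℂ) + 1) * τ - z))) := by
        unfold PN
        rw [Finset.prod_range_succ]
      rw [hP]
      simp only [add_mul, two_mul, one_mul, sub_eq_add_neg, e2_add, e2_neg]
      have hZ := e2_ne z
      generalize e2 z = Z at hZ ⊢
      generalize e2 (N * τ) = NN
      generalize e2 τ = Q
      field_simp
      ring

theorem PN_zero (τ : ℂ) (N : ℕ) : PN τ 0 (N + 1) = 0 := by
  unfold PN
  exact Finset.prod_eq_zero (Finset.mem_range.2 (Nat.succ_pos N)) (by simp [e2_zero])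

theorem PN_tau (τ : ℂ) (N : ℕ) : PN τ τ (N + 1) = 0 := by
  unfold PN
  exact Finset.prod_eq_zero (Finset.mem_range.2 (Nat.succ_pos N)) (by simp [e2_zero])

theorem PN_ne {τ z : ℂ} (hz : ∀ a b : ℤ, z ≠ (a : ℂ) + (b : ℂ) * τ) (N : ℕ) : PN τ z N ≠ 0 := by
  unfold PN
  refine Finset.prod_ne_zero_iff.2 fun i _ => mul_ne_zero ?_ ?_
  · simpa using e2_one_sub_ne hz i
  · have h := e2_one_sub_ne hz (-(i + 1))
    push_cast at h
    intro h'
    apply h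
    have h2 : e2 (((i : ℂ) + 1) * τ - z) = 1 := by linear_combination -h'
    have h3 : z + -((i : ℂ) + 1) * τ = -(((i : ℂ) + 1) * τ - z) := by ring
    rw [h3, e2_neg, h2]; simp

theorem pf_fin {τ z : ℂ} (hτ : 0 < τ.im) (hz : ∀ a b : ℤ, z ≠ (a : ℂ) + (b : ℂ) * τ) (N : ℕ) :
    HasSum (fun j : ℤ => cN τ N j * e2 (j * τ) * (1 - e2 (z + j * τ))⁻¹)
      (PN τ z N * (1 - e2 (z + N * τ)))⁻¹ := by
  induction N with
  | zero =>
    have := hasSum_single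
      (f := fun j : ℤ => cN τ (0 : ℕ) j * e2 (j * τ) * (1 - e2 (z + j * τ))⁻¹) 0 (by
      intro j hj
      have : rq τ (0 - j) * rq τ (0 + j) = 0 := by
        rcases lt_or_gt_of_ne hj with h | h
        · have : rq τ (0 + j) = 0 := by simp [rq, h]
          rw [this, mul_zero]
        · have : rq τ (0 - j) = 0 := by simp [rq, h]
          rw [this, zero_mul]
      simp only [cN, Nat.cast_zero]
      rw [mul_assoc ((-1 : ℂ) ^ j * _), this]; simp)
    simpa [cN, PN, rq, e2_zero] using this
  | succ N ih =>
    have hU : (1 - e2 (z + ((N : ℂ) + 1) * τ)) ≠ 0 := by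
      simpa using e2_one_sub_ne hz (N + 1)
    have hP : PN τ z (N + 1) = PN τ z N *
        ((1 - e2 (z + N * τ)) * (1 - e2 (((N : ℂ) + 1) * τ - z))) := by
      unfold PN
      rw [Finset.prod_range_succ]
    have hV : (1 - e2 (((N : ℂ) + 1) * τ - z)) ≠ 0 := by
      have h := PN_ne hz (N + 1)
      rw [hP] at h
      exact right_ne_zero_of_mul (right_ne_zero_of_mul h)
    have h1 := (jtp_fin hτ 0 (N + 1)).mul_left (e2 (((N : ℂ) + 1) * τ))
    have h2 := (jtp_fin hτ τ (N + 1)).mul_left (e2 (((N : ℂ) + 1) * τ) * e2 (-z))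
    rw [PN_zero, zero_mul, mul_zero] at h1
    rw [PN_tau, zero_mul, mul_zero] at h2
    have h := ((ih.sub h2).add h1).mul_left
      ((1 - e2 (z + ((N : ℂ) + 1) * τ)) * (1 - e2 (((N : ℂ) + 1) * τ - z)))⁻¹
    refine hasSum_of_eq h ?_ ?_
    · funext j
      rw [eq_inv_mul_iff_mul_eq₀ (mul_ne_zero hU hV)]
      have hj := e2_one_sub_ne hz j
      have a1 := rq_rec hτ (N + 1 - j)
      have b1 := rq_rec hτ (N + 1 + j)
      rw [show (N : ℤ) + 1 - j - 1 = N - j by ring] at a1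
      rw [show (N : ℤ) + 1 + j - 1 = N + j by ring] at b1
      unfold cN
      push_cast at a1 b1 ⊢
      rw [a1, b1, mul_zero, e2_zero]
      generalize e2 ((j : ℂ) * (j - 1) / 2 * τ) = EE
      simp only [add_mul, one_mul, sub_eq_add_neg, e2_add, e2_neg, neg_mul] at hj ⊢
      have hZ := e2_ne z
      have hJ := e2_ne (j * τ)
      generalize e2 z = Z at hZ hj ⊢
      generalize e2 (j * τ) = J at hJ hj ⊢
      generalize e2 (N * τ) = NN
      generalize e2 τ = Q
      generalize rq τ ((N : ℤ) + 1 + -j) = R1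
      generalize rq τ ((N : ℤ) + 1 + j) = R2
      generalize (-1 : ℂ) ^ j = W
      simp only [← sub_eq_add_neg] at hj ⊢
      have hj' : 1 - J * Z ≠ 0 := by rwa [mul_comm]
      field_simp
      ring
    · rw [hP]
      push_cast
      simp only [mul_inv]
      ring

/-- normalized theta series -/
def TT (τ z : ℂ) : ℂ := ∑' j : ℤ, (-1) ^ j * e2 ((j : ℂ) * (j - 1) / 2 * τ) * e2 (j * z)

/-- normalized Appell sum -/
def AA (τ z : ℂ) : ℂ :=
  ∑' j : ℤ, (-1) ^ j * e2 ((j : ℂ) * (j - 1) / 2 * τ) * e2 (j * τ) * (1 - e2 (z + j * τ))⁻¹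

theorem cN_tendsto {τ : ℂ} (hτ : 0 < τ.im) (j : ℤ) :
    Filter.Tendsto (fun N : ℕ => cN τ N j) Filter.atTop
      (nhds ((-1) ^ j * e2 ((j : ℂ) * (j - 1) / 2 * τ) * (eulq τ)⁻¹ * (eulq τ)⁻¹)) := by
  unfold cN
  have hN : Filter.Tendsto (fun N : ℕ => (N : ℤ)) Filter.atTop Filter.atTop :=
    tendsto_natCast_atTop_atTop
  refine (tendsto_const_nhds.mul ((rq_tendsto hτ).comp ?_)).mul ((rq_tendsto hτ).comp ?_)
  · exact Filter.tendsto_atTop_add_const_right _ (-j) hN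
  · exact Filter.tendsto_atTop_add_const_right _ j hN

theorem cN_bound {τ : ℂ} {R : ℝ} (hR0 : 0 ≤ R) (hR : ∀ n, ‖rq τ n‖ ≤ R) (N j : ℤ) :
    ‖cN τ N j‖ ≤ R * R * ‖e2 ((j : ℂ) * (j - 1) / 2 * τ)‖ := by
  unfold cN
  rw [norm_mul, norm_mul, norm_mul, norm_neg_one_zpow, one_mul]
  have h1 := hR (N - j)
  have h2 := hR (N + j)
  have h3 := norm_nonneg (e2 ((j : ℂ) * (j - 1) / 2 * τ))
  have h4 := norm_nonneg (rq τ (N - j))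
  have h5 := norm_nonneg (rq τ (N + j))
  calc _ = (‖rq τ (N - j)‖ * ‖rq τ (N + j)‖) * ‖e2 ((j : ℂ) * (j - 1) / 2 * τ)‖ := by ring
    _ ≤ _ := by gcongr

theorem half_im {τ : ℂ} (hτ : 0 < τ.im) : 0 < (τ / 2).im := by
  have : τ / 2 = ((1 / 2 : ℝ) : ℂ) * τ := by push_cast; ring
  rw [this, Complex.im_ofReal_mul]; positivity

theorem TT_mul_AA {τ z : ℂ} (hτ : 0 < τ.im) (hz : ∀ a b : ℤ, z ≠ (a : ℂ) + (b : ℂ) * τ) :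
    TT τ z * AA τ z = eulq τ ^ 3 := by
  obtain ⟨R, hR0, hR⟩ := rq_bdd hτ
  obtain ⟨C, hC0, hC⟩ := bdd_inv (z := z) hτ
  have hE := eulq_ne hτ
  have t1 : Filter.Tendsto (fun N : ℕ => ∑' j : ℤ, cN τ N j * e2 (j * z)) Filter.atTop
      (nhds (∑' j : ℤ, (-1) ^ j * e2 ((j : ℂ) * (j - 1) / 2 * τ) * (eulq τ)⁻¹ * (eulq τ)⁻¹ *
        e2 (j * z))) := by
    refine tendsto_tsum_of_dominated_convergence
      (bound := fun j : ℤ => R * R * ‖e2 (τ / 2 * (j : ℂ) ^ 2 + (z - τ / 2) * j + 0)‖) ?_ ?_ ?_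
    · exact (summable_gauss (half_im hτ) _ _).mul_left _
    · exact fun j => (cN_tendsto hτ j).mul tendsto_const_nhds
    · refine Filter.Eventually.of_forall fun N j => ?_
      rw [norm_mul, show τ / 2 * (j : ℂ) ^ 2 + (z - τ / 2) * j + 0 =
        (j : ℂ) * (j - 1) / 2 * τ + j * z by ring, e2_add, norm_mul, ← mul_assoc]
      exact mul_le_mul_of_nonneg_right (cN_bound hR0 hR _ _) (norm_nonneg _)
  have t2 : Filter.Tendsto
      (fun N : ℕ => ∑' j : ℤ, cN τ N j * e2 (j * τ) * (1 - e2 (z + j * τ))⁻¹) Filter.atTop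
      (nhds (∑' j : ℤ, (-1) ^ j * e2 ((j : ℂ) * (j - 1) / 2 * τ) * (eulq τ)⁻¹ * (eulq τ)⁻¹ *
        e2 (j * τ) * (1 - e2 (z + j * τ))⁻¹)) := by
    refine tendsto_tsum_of_dominated_convergence
      (bound := fun j : ℤ => R * R * ‖e2 (τ / 2 * (j : ℂ) ^ 2 + (τ / 2) * j + 0)‖ * C) ?_ ?_ ?_
    · exact ((summable_gauss (half_im hτ) _ _).mul_left _).mul_right _
    · exact fun j => ((cN_tendsto hτ j).mul tendsto_const_nhds).mul tendsto_const_nhds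
    · refine Filter.Eventually.of_forall fun N j => ?_
      rw [norm_mul, norm_mul, show τ / 2 * (j : ℂ) ^ 2 + (τ / 2) * j + 0 =
        (j : ℂ) * (j - 1) / 2 * τ + j * τ by ring, e2_add ((j : ℂ) * (j - 1) / 2 * τ), norm_mul, ← mul_assoc]
      have := cN_bound hR0 hR N j
      have := hC j
      gcongr
  have e1 : (∑' j : ℤ, (-1) ^ j * e2 ((j : ℂ) * (j - 1) / 2 * τ) * (eulq τ)⁻¹ * (eulq τ)⁻¹ *
        e2 (j * z)) = (eulq τ)⁻¹ * (eulq τ)⁻¹ * TT τ z := by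
    rw [TT, ← tsum_mul_left]
    exact tsum_congr fun j => by ring
  have e3 : (∑' j : ℤ, (-1) ^ j * e2 ((j : ℂ) * (j - 1) / 2 * τ) * (eulq τ)⁻¹ * (eulq τ)⁻¹ *
        e2 (j * τ) * (1 - e2 (z + j * τ))⁻¹) = (eulq τ)⁻¹ * (eulq τ)⁻¹ * AA τ z := by
    rw [AA, ← tsum_mul_left]
    exact tsum_congr fun j => by ring
  rw [e1] at t1
  rw [e3] at t2
  have hq : Filter.Tendsto (fun n : ℕ => e2 τ ^ n) Filter.atTop (nhds 0) :=
    tendsto_pow_atTop_nhds_zero_of_norm_lt_one (norm_e2_lt_one hτ)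
  have t3 : Filter.Tendsto (fun n : ℕ => 1 - e2 z * e2 τ ^ n) Filter.atTop
      (nhds ((1 : ℂ) - e2 z * 0)) :=
    tendsto_const_nhds.sub (tendsto_const_nhds.mul hq)
  have t4 := (t1.mul t2).mul t3
  have t5 : Filter.Tendsto (fun N : ℕ => rq τ (2 * N)) Filter.atTop (nhds (eulq τ)⁻¹) := by
    refine (rq_tendsto hτ).comp (Filter.tendsto_atTop.2 fun b => ?_)
    filter_upwards [Filter.eventually_ge_atTop b.toNat] with n hn
    omega
  have h6 := tendsto_nhds_unique (t4.congr fun N => by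
    rw [(jtp_fin hτ z N).tsum_eq, (pf_fin hτ hz N).tsum_eq]
    have h1 := PN_ne hz N
    have h2 := e2_one_sub_ne hz N
    simp only [Int.cast_natCast] at h2
    rw [← e2_nat, ← e2_add]
    generalize 1 - e2 (z + N * τ) = Y at h2 ⊢
    show _ = rq τ (2 * N)
    field_simp) t5
  rw [mul_zero, sub_zero, mul_one] at h6
  field_simp at h6
  linear_combination h6

theorem theta11_eq (τ z : ℂ) : theta11 τ z = -Complex.I * e2 (τ / 8 - z / 2) * TT τ z := by
  unfold theta11 TT
  rw [← (Equiv.subRight (1 : ℤ)).tsum_eq, mul_assoc, ← tsum_mul_left (a := e2 _), neg_mul,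
    ← mul_neg, ← tsum_neg]
  congr 1
  refine tsum_congr fun j => ?_
  simp only [Equiv.subRight_apply]
  rw [zpow_sub_one₀ (by norm_num)]
  push_cast
  rw [show ((j : ℂ) - 1 + 1 / 2) ^ 2 / 2 * τ + (j - 1 + 1 / 2) * z =
    (τ / 8 - z / 2) + (j : ℂ) * (j - 1) / 2 * τ + j * z by ring, e2_add, e2_add]
  norm_num
  ring

theorem theta11_ne {τ z : ℂ} (hτ : 0 < τ.im) (hz : ∀ a b : ℤ, z ≠ (a : ℂ) + (b : ℂ) * τ) :
    theta11 τ z ≠ 0 := by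
  have h := TT_mul_AA hτ hz
  have h1 : TT τ z * AA τ z ≠ 0 := by rw [h]; exact pow_ne_zero _ (eulq_ne hτ)
  rw [theta11_eq]
  exact mul_ne_zero (mul_ne_zero (neg_ne_zero.2 Complex.I_ne_zero) (e2_ne _))
    (left_ne_zero_of_mul h1)

theorem AA_eq {τ z : ℂ} (hτ : 0 < τ.im) (hz : ∀ a b : ℤ, z ≠ (a : ℂ) + (b : ℂ) * τ) :
    AA τ z = -Complex.I * dedekindEta τ ^ 3 / theta11 τ z * e2 (-z / 2) := by
  have h := TT_mul_AA hτ hz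
  have h0 := theta11_ne hτ hz
  rw [div_mul_eq_mul_div, eq_div_iff h0, theta11_eq]
  have h2 : dedekindEta τ = e2 (τ / 24) * eulq τ := rfl
  rw [h2, mul_pow, ← h, ← e2_nat, show τ / 8 - z / 2 = ((3 : ℕ) : ℂ) * (τ / 24) + -z / 2 by
    push_cast; ring, e2_add]
  ring

/-- general Appell sum term -/
def kt (τ z : ℂ) (S j : ℤ) : ℂ :=
  (-1) ^ j * e2 ((j : ℂ) ^ 2 / 2 * τ - ((S : ℂ) + 1 / 2) * j * τ) / (1 - e2 (z + j * τ))

theorem kt_summable {τ : ℂ} (z : ℂ) (hτ : 0 < τ.im) (S : ℤ) : Summable (kt τ z S) := by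
  obtain ⟨C, hC0, hC⟩ := bdd_inv (z := z) hτ
  refine Summable.of_norm_bounded ((summable_gauss (half_im hτ) (-((S : ℂ) + 1 / 2) * τ) 0).mul_right C)
    fun j => ?_
  unfold kt
  rw [div_eq_mul_inv, norm_mul, norm_mul, norm_neg_one_zpow, one_mul]
  rw [show (j : ℂ) ^ 2 / 2 * τ - ((S : ℂ) + 1 / 2) * j * τ =
    τ / 2 * (j : ℂ) ^ 2 + -((S : ℂ) + 1 / 2) * τ * j + 0 by ring]
  exact mul_le_mul_of_nonneg_left (hC j) (norm_nonneg _)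

theorem half_theta_zero (τ : ℂ) (S : ℤ) :
    ∑' j : ℤ, (-1 : ℂ) ^ j * e2 ((j : ℂ) ^ 2 / 2 * τ - ((S : ℂ) + 1 / 2) * j * τ) = 0 := by
  have h : ∑' j : ℤ, (-1 : ℂ) ^ j * e2 ((j : ℂ) ^ 2 / 2 * τ - ((S : ℂ) + 1 / 2) * j * τ) =
      -∑' j : ℤ, (-1 : ℂ) ^ j * e2 ((j : ℂ) ^ 2 / 2 * τ - ((S : ℂ) + 1 / 2) * j * τ) := by
    conv_lhs => rw [← (Equiv.subLeft (2 * S + 1)).tsum_eq]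
    rw [← tsum_neg]
    refine tsum_congr fun j => ?_
    simp only [Equiv.subLeft_apply]
    have hs : (-1 : ℂ) ^ (2 * S + 1 - j) = -(-1) ^ j := by
      rw [zpow_sub₀ (by norm_num), zpow_add₀ (by norm_num), zpow_mul]
      have : ((-1 : ℂ) ^ j) * (-1) ^ j = 1 := by rw [← mul_zpow]; norm_num
      have h3 : ((-1 : ℂ) ^ j) ≠ 0 := zpow_ne_zero _ (by norm_num)
      rw [div_eq_iff h3, neg_mul, this]
      norm_num
    rw [hs, neg_mul]
    congr 3
    push_cast
    ring
  linear_combination h / 2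

theorem kt_step {τ z : ℂ} (hτ : 0 < τ.im) (hz : ∀ a b : ℤ, z ≠ (a : ℂ) + (b : ℂ) * τ) (S : ℤ) :
    ∑' j, kt τ z (S + 1) j = e2 z * ∑' j, kt τ z S j := by
  rw [← tsum_mul_left, ← sub_eq_zero,
    ← (kt_summable z hτ (S + 1)).tsum_sub ((kt_summable z hτ S).mul_left _),
    ← half_theta_zero τ (S + 1)]
  refine tsum_congr fun j => ?_
  unfold kt
  have hj := e2_one_sub_ne hz j
  have h1 : (j : ℂ) ^ 2 / 2 * τ - ((S : ℂ) + 1 / 2) * j * τ =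
    ((j : ℂ) ^ 2 / 2 * τ - (((S + 1 : ℤ) : ℂ) + 1 / 2) * j * τ) + j * τ := by push_cast; ring
  rw [h1, e2_add (_ - _) (j * τ), mul_div_assoc', div_sub_div_same, div_eq_iff hj, e2_add z]
  ring

theorem kt_tsum {τ z : ℂ} (hτ : 0 < τ.im) (hz : ∀ a b : ℤ, z ≠ (a : ℂ) + (b : ℂ) * τ) (S : ℤ) :
    ∑' j, kt τ z S j =
      -Complex.I * dedekindEta τ ^ 3 / theta11 τ z * e2 (((S : ℂ) + 1 / 2) * z) := by
  induction S using Int.induction_on with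
  | zero =>
    have h0 := kt_step hτ hz (-1)
    rw [show (-1 : ℤ) + 1 = 0 by ring] at h0
    have h1 : ∑' j, kt τ z (-1) j = AA τ z := by
      unfold AA
      refine tsum_congr fun j => ?_
      unfold kt
      rw [div_eq_mul_inv, mul_assoc ((-1 : ℂ) ^ j) (e2 _) (e2 _), ← e2_add]
      congr 3
      push_cast
      ring
    rw [h0, h1, AA_eq hτ hz, show (((0 : ℤ) : ℂ) + 1 / 2) * z = z + -z / 2 by push_cast; ring,
      e2_add]
    ring
  | succ i ih =>
    rw [kt_step hτ hz, ih]
    rw [show (((i : ℤ) + 1 : ℤ) + 1 / 2 : ℂ) * z = z + (((i : ℤ) : ℂ) + 1 / 2) * z by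
      push_cast; ring, e2_add]
    ring
  | pred i ih =>
    have h0 := kt_step hτ hz (-(i : ℤ) - 1)
    rw [sub_add_cancel, ih] at h0
    apply mul_left_cancel₀ (e2_ne z)
    rw [← h0, show ((-(i : ℤ) : ℤ) + 1 / 2 : ℂ) * z = z + (((-(i : ℤ) - 1 : ℤ) : ℂ) + 1 / 2) * z by
      push_cast; ring, e2_add]
    ring

/-- sign of the indefinite region -/
def sg (j p : ℤ) : ℂ := (if 0 < p ∧ p ≤ j then 1 else 0) - (if j < p ∧ p ≤ 0 then 1 else 0)

theorem sg_succ (j p : ℤ) : sg (j + 1) p = sg j p + if p = j + 1 then 1 else 0 := by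
  unfold sg
  split_ifs <;> first | omega | (exfalso; omega) | norm_num

theorem sg_norm (j p : ℤ) : ‖sg j p‖ ≤ 1 := by
  unfold sg
  by_cases h1 : 0 < p ∧ p ≤ j
  · have h2 : ¬ (j < p ∧ p ≤ 0) := by omega
    simp [h1, h2]
  · by_cases h2 : j < p ∧ p ≤ 0
    · simp [h1, h2]
    · simp [h1, h2]

theorem sg_sq {j p : ℤ} (h : sg j p ≠ 0) : p ^ 2 ≤ j ^ 2 := by
  unfold sg at h
  by_cases h1 : 0 < p ∧ p ≤ j
  · nlinarith
  · by_cases h2 : j < p ∧ p ≤ 0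
    · nlinarith
    · simp [h1, h2] at h

theorem sg_hasSum (H : ℤ → ℂ) (j : ℤ) :
    HasSum (fun p => sg j p * (H p - H (p - 1))) (H j - H 0) := by
  have key : ∀ j : ℤ, HasSum (fun p : ℤ => (if p = j + 1 then (1 : ℂ) else 0) * (H p - H (p - 1)))
      (H (j + 1) - H j) := by
    intro j
    have := hasSum_single (f := fun p : ℤ => (if p = j + 1 then (1 : ℂ) else 0) * (H p - H (p - 1)))
      (j + 1) (by intro p hp; simp [hp])
    simpa using this
  induction j using Int.induction_on with
  | zero =>
    have : (fun p => sg 0 p * (H p - H (p - 1))) = fun _ => 0 := by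
      funext p
      have : sg 0 p = 0 := by
        unfold sg
        exact sub_self _
      rw [this, zero_mul]
    rw [this, sub_self]
    exact hasSum_zero
  | succ i ih =>
    refine hasSum_of_eq (ih.add (key i)) ?_ (by ring)
    funext p
    rw [sg_succ]; ring
  | pred i ih =>
    refine hasSum_of_eq (ih.sub (key (-(i : ℤ) - 1))) ?_ ?_
    · funext p
      have := sg_succ (-(i : ℤ) - 1) p
      rw [sub_add_cancel] at this
      rw [this]
      simp only [sub_add_cancel]
      ring
    · rw [sub_add_cancel]; ring

theorem geo_hasSum {y : ℂ} (hy0 : y ≠ 0) (hy1 : 1 - y ≠ 0) (M : ℕ) (j : ℤ) :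
    HasSum (fun p : ℤ => ∑ r ∈ Finset.range M, sg j p * y ^ ((r : ℤ) - p * (M : ℤ)))
      ((y ^ (-(j * (M : ℤ))) - 1) / (1 - y)) := by
  have h := (sg_hasSum (fun p => y ^ (-(p * (M : ℤ)))) j).mul_right (1 - y)⁻¹
  refine hasSum_of_eq h ?_ ?_
  · funext p
    rw [← Finset.mul_sum, mul_assoc]
    congr 1
    rw [eq_mul_inv_iff_mul_eq₀ hy1]
    have h1 : ∀ r ∈ Finset.range M, y ^ ((r : ℤ) - p * (M : ℤ)) = y ^ (-(p * (M : ℤ))) * y ^ r := by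
      intro r _
      rw [← zpow_natCast, ← zpow_add₀ hy0]
      congr 1; ring
    rw [Finset.sum_congr rfl h1, ← Finset.mul_sum, mul_assoc, geom_sum_mul_neg]
    rw [show -((p - 1) * (M : ℤ)) = -(p * (M : ℤ)) + (M : ℤ) by ring, zpow_add₀ hy0, zpow_natCast]
    ring
  · simp [div_eq_mul_inv]

theorem neg_one_zpow_neg (j : ℤ) : (-1 : ℂ) ^ (-j) = (-1) ^ j := by
  rw [zpow_neg, ← inv_zpow]; norm_num

theorem mul_tau_im {τ : ℂ} (hτ : 0 < τ.im) {a : ℝ} (ha : 0 < a) : 0 < ((a : ℂ) * τ).im := by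
  rw [Complex.im_ofReal_mul]; positivity

theorem jtheta_summable {ε : ℂ} (hε : ‖ε‖ = 1) (n m τ z : ℂ) (h : 0 < (m * τ).im) :
    Summable fun j : ℤ => ‖ε ^ j *
      e2 (m * ((j : ℂ) + n / (2 * m)) ^ 2 * τ + m * ((j : ℂ) + n / (2 * m)) * z)‖ := by
  refine (summable_gauss h (2 * m * (n / (2 * m)) * τ + m * z)
    (m * (n / (2 * m)) ^ 2 * τ + m * (n / (2 * m)) * z)).congr fun j => ?_
  rw [norm_mul, norm_zpow, hε, one_zpow, one_mul]
  congr 2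
  ring

theorem phi_summable {m τ : ℂ} (z₁ z₂ : ℂ) (hτ : 0 < τ.im) (h : 0 < (m * τ).im) :
    Summable fun j : ℤ => ‖(1 : ℂ) ^ j *
    e2 (m * (j : ℂ) * (z₁ + z₂) + 0 * z₁ + (m * (j : ℂ) ^ 2 + 0 * (j : ℂ)) * τ) /
      (1 - e2 (z₁ + (j : ℂ) * τ))‖ := by
  obtain ⟨C, hC0, hC⟩ := bdd_inv (z := z₁) hτ
  refine Summable.of_nonneg_of_le (fun _ => norm_nonneg _) (fun j => ?_)
    ((summable_gauss h (m * (z₁ + z₂)) 0).mul_right C)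
  rw [one_zpow, one_mul, div_eq_mul_inv, norm_mul]
  rw [show m * (j : ℂ) * (z₁ + z₂) + 0 * z₁ + (m * (j : ℂ) ^ 2 + 0 * (j : ℂ)) * τ =
    m * τ * (j : ℂ) ^ 2 + m * (z₁ + z₂) * j + 0 by ring]
  exact mul_le_mul_of_nonneg_left (hC j) (norm_nonneg _)

theorem fcoef_summable {M : ℕ} (hM : 0 < M) {m : ℂ} (hm : m = (M : ℂ) / 2) (s : ℂ)
    {τ : ℂ} (hτ : 0 < τ.im) (z₁ z₂ : ℂ) (r : ℕ) :
    Summable fun x : ℤ × ℤ =>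
      ‖sg x.1 x.2 * fcoef m s τ z₁ z₂ (-x.1) ((r : ℤ) - x.2 * (M : ℤ))‖ := by
  have hq : 0 < (τ / 4).im := by
    have : τ / 4 = ((1 / 4 : ℝ) : ℂ) * τ := by push_cast; ring
    rw [this, Complex.im_ofReal_mul]; positivity
  have hM0 : (M : ℂ) ≠ 0 := by exact_mod_cast hM.ne'
  have hM1 : (M : ℂ) + 1 ≠ 0 := by exact_mod_cast (Nat.succ_ne_zero M)
  have h1 := summable_gauss hq (-s * τ + m * (z₁ - z₂)) 0
  have h2 := summable_gauss hq (r * τ - M * (z₁ - z₂) / 2)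
    (((m + 1 / 2) * (s / (2 * m + 1)) ^ 2 - (r : ℂ) ^ 2 / (4 * m)) * τ + r / 2 * (z₁ - z₂))
  refine Summable.of_nonneg_of_le (fun _ => norm_nonneg _) (fun x => ?_)
    (h1.mul_of_nonneg h2 (fun _ => norm_nonneg _) (fun _ => norm_nonneg _))
  obtain ⟨j, p⟩ := x
  by_cases h0 : sg j p = 0
  · simp only [h0, zero_mul, norm_zero]; positivity
  simp only
  have hjp := sg_sq h0
  rw [norm_mul]
  refine le_trans (mul_le_of_le_one_left (norm_nonneg _) (sg_norm j p)) ?_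
  unfold fcoef
  rw [norm_mul, norm_neg_one_zpow, one_mul, ← norm_mul, ← e2_add]
  apply norm_e2_le
  have hD : ((m + 1 / 2) * (((-j : ℤ) : ℂ) + s / (2 * m + 1)) ^ 2 -
        (((r : ℤ) - p * (M : ℤ) : ℤ) : ℂ) ^ 2 / (4 * m)) * τ +
      (-(((-j : ℤ) : ℂ) * m) + (((r : ℤ) - p * (M : ℤ) : ℤ) : ℂ) / 2) * (z₁ - z₂) =
      (τ / 4 * (j : ℂ) ^ 2 + (-s * τ + m * (z₁ - z₂)) * j + 0 + (τ / 4 * (p : ℂ) ^ 2 +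
        (r * τ - M * (z₁ - z₂) / 2) * p +
    (((m + 1 / 2) * (s / (2 * m + 1)) ^ 2 - (r : ℂ) ^ 2 / (4 * m)) * τ + r / 2 * (z₁ - z₂)))) +
      ((((M : ℝ) / 2 + 1 / 4) * ((j : ℝ) ^ 2 - (p : ℝ) ^ 2) : ℝ) : ℂ) * τ := by
    subst hm
    have hM2 : 2 * ((M : ℂ) / 2) + 1 = M + 1 := by ring
    rw [hM2]
    push_cast
    field_simp
    ring
  rw [hD, Complex.add_im _ (_ * τ), Complex.im_ofReal_mul]
  have : (0 : ℝ) ≤ (j : ℝ) ^ 2 - (p : ℝ) ^ 2 := by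
    have : ((p ^ 2 : ℤ) : ℝ) ≤ ((j ^ 2 : ℤ) : ℝ) := by exact_mod_cast hjp
    push_cast at this
    linarith
  have : 0 ≤ ((M : ℝ) / 2 + 1 / 4) * ((j : ℝ) ^ 2 - (p : ℝ) ^ 2) * τ.im := by positivity
  linarith

/-- reindexing `(j,n) ↦ (-j, n+j)` -/
def eqA : ℤ × ℤ ≃ ℤ × ℤ where
  toFun x := (-x.1, x.2 + x.1)
  invFun x := (-x.1, x.2 + x.1)
  left_inv x := by ext <;> simp
  right_inv x := by ext <;> simp

/-- reindexing `((j,n),p) ↦ ((j,p), n+j-p)` -/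
def eqB : (ℤ × ℤ) × ℤ ≃ (ℤ × ℤ) × ℤ where
  toFun x := ((x.1.1, x.2), x.1.2 + x.1.1 - x.2)
  invFun x := ((x.1.1, x.2 - x.1.1 + x.1.2), x.1.2)
  left_inv x := by ext <;> simp <;> ring
  right_inv x := by ext <;> simp <;> ring

theorem hasSum_of_eq' {ι : Type*} {f g : ι → ℂ} {a b : ℂ} (h : HasSum g b) (hf : ∀ x, f x = g x)
    (ha : a = b) : HasSum f a := by rw [funext hf, ha]; exact h

/-- common constant exponent -/
def kap (m s τ u : ℂ) : ℂ := s ^ 2 / (2 * (2 * m + 1)) * τ - m * s * u / (2 * m + 1)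

/-- common factor -/
def Xf (m s τ z₁ z₂ : ℂ) (j n : ℤ) : ℂ := (-1) ^ j *
    e2 (kap m s τ (z₁ - z₂) + ((m + 1 / 2) * (j : ℂ) ^ 2 - s * j + m * ((n : ℂ) + j) ^ 2) * τ +
      j * (2 * m) * z₁ + m * n * (z₁ + z₂))

/-- geometric ratio -/
def Yf (τ z₁ : ℂ) (j n : ℤ) : ℂ := e2 (z₁ + ((n + j : ℤ) : ℂ) * τ)

theorem e2_cong2 {a b c g : ℂ} (h : a + b = c) : g * e2 a * e2 b = g * e2 c := by
  rw [mul_assoc, ← e2_add, h]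

theorem prod_hasSum {ι α β : Type*} (e : ι ≃ α × β) {f : α → ℂ} {g : β → ℂ}
    (hf : Summable fun a => ‖f a‖) (hg : Summable fun b => ‖g b‖) :
    HasSum (fun x => f (e x).1 * g (e x).2) ((∑' a, f a) * ∑' b, g b) :=
  e.hasSum_iff.2 (hf.of_norm.hasSum.mul hg.of_norm.hasSum (summable_mul_of_summable_norm hf hg))

theorem partA {m s τ z₁ z₂ : ℂ} (hm1 : 2 * m + 1 ≠ 0) (hτ : 0 < τ.im) (him : 0 < (m * τ).im)
    (him1 : 0 < ((m + 1 / 2) * τ).im) :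
    HasSum (fun x : ℤ × ℤ => Xf m s τ z₁ z₂ x.1 x.2 / (1 - Yf τ z₁ x.1 x.2))
      (jtheta (-1) s (m + 1 / 2) τ (-(2 * m * (z₁ - z₂)) / (2 * m + 1)) *
        Phi1 1 m 0 τ z₁ z₂) := by
  have hn1 : ‖(-1 : ℂ)‖ = 1 := by simp
  have sA := jtheta_summable hn1 s (m + 1 / 2) τ (-(2 * m * (z₁ - z₂)) / (2 * m + 1)) him1
  have sP := phi_summable z₁ z₂ hτ him
  have HA := prod_hasSum eqA sA sP
  refine hasSum_of_eq' HA (fun x => ?_) ?_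
  · obtain ⟨j, n⟩ := x
    simp only [eqA, Equiv.coe_fn_mk, Xf, Yf]
    rw [mul_div_assoc', neg_one_zpow_neg, one_zpow, one_mul, e2_cong2]
    unfold kap
    rw [show (m + 1 / 2 : ℂ) = (2 * m + 1) / 2 by ring]
    push_cast
    obtain ⟨D, hD⟩ : ∃ D, D = 2 * m + 1 := ⟨_, rfl⟩
    rw [← hD] at hm1 ⊢
    field_simp
    rw [hD]
    ring
  · unfold jtheta Phi1; rfl

theorem partB0 {M : ℕ} (hM : 0 < M) {m : ℂ} (hm : m = (M : ℂ) / 2) (s : ℂ)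
    {τ : ℂ} (hτ : 0 < τ.im) (him : 0 < (m * τ).im) (z₁ z₂ : ℂ) (r : ℕ) :
    HasSum (fun x : (ℤ × ℤ) × ℤ =>
      (sg x.1.1 x.2 * fcoef m s τ z₁ z₂ (-x.1.1) ((r : ℤ) - x.2 * (M : ℤ))) *
      ((1 : ℂ) ^ (x.1.2 + x.1.1 - x.2) *
        e2 (m * (((x.1.2 + x.1.1 - x.2 : ℤ) : ℂ) + (r : ℂ) / (2 * m)) ^ 2 * τ +
          m * (((x.1.2 + x.1.1 - x.2 : ℤ) : ℂ) + (r : ℂ) / (2 * m)) * (z₁ + z₂))))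
      ((indefSum fun j p => fcoef m s τ z₁ z₂ (-j) ((r : ℤ) - p * (M : ℤ))) *
            jtheta 1 (r : ℂ) m τ (z₁ + z₂)) := by
  have hp1 : ‖(1 : ℂ)‖ = 1 := by simp
  have sF := fcoef_summable hM hm s hτ z₁ z₂ r
  have sT := jtheta_summable hp1 (r : ℂ) m τ (z₁ + z₂) him
  have h := prod_hasSum eqB sF sT
  refine hasSum_of_eq' h (fun x => ?_) ?_
  · simp only [eqB, Equiv.coe_fn_mk]
  · unfold jtheta
    congr 1
    unfold indefSum
    refine tsum_congr fun x => ?_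
    unfold sg
    rw [sub_mul]
    simp only [ite_mul, one_mul, zero_mul]

theorem e2_cong3 {a b c d e f g : ℂ} (h : a + c + d = e + f) :
    e2 a * (b * (g * e2 c) * e2 d) = g * e2 e * (b * e2 f) := by
  have : e2 a * e2 c * e2 d = e2 e * e2 f := by rw [← e2_add, ← e2_add, ← e2_add, h]
  linear_combination b * g * this

theorem partB {M : ℕ} (hM : 0 < M) {m : ℂ} (hm : m = (M : ℂ) / 2) (s : ℂ)
    {τ : ℂ} (hτ : 0 < τ.im) (him : 0 < (m * τ).im) (z₁ z₂ : ℂ)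
    (hm0 : m ≠ 0) (hm1 : 2 * m + 1 ≠ 0)
    (hz : ∀ a b : ℤ, z₁ ≠ (a : ℂ) + (b : ℂ) * τ) :
    HasSum (fun x : ℤ × ℤ => Xf m s τ z₁ z₂ x.1 x.2 *
      ((Yf τ z₁ x.1 x.2 ^ (-(x.1 * (M : ℤ))) - 1) / (1 - Yf τ z₁ x.1 x.2)))
      (e2 (-(m * s * (z₁ - z₂)) / (2 * m + 1)) *
        ∑ r ∈ Finset.range M,
          (indefSum fun j p => fcoef m s τ z₁ z₂ (-j) ((r : ℤ) - p * (M : ℤ))) *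
            jtheta 1 (r : ℂ) m τ (z₁ + z₂)) := by
  have hM2 : (M : ℂ) = 2 * m := by rw [hm]; ring
  have HB1 := (hasSum_sum (s := Finset.range M) fun r _ => partB0 hM hm s hτ him z₁ z₂ r).mul_left
    (e2 (-(m * s * (z₁ - z₂)) / (2 * m + 1)))
  refine HB1.prod_fiberwise fun x => ?_
  refine hasSum_of_eq' ((geo_hasSum (y := Yf τ z₁ x.1 x.2) (e2_ne _)
    (e2_one_sub_ne hz _) M x.1).mul_left (Xf m s τ z₁ z₂ x.1 x.2)) (fun p => ?_) rfl
  rw [Finset.mul_sum, Finset.mul_sum]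
  refine Finset.sum_congr rfl fun r _ => ?_
  obtain ⟨j, n⟩ := x
  simp only [Xf, Yf, fcoef]
  rw [← e2_int, neg_one_zpow_neg, one_zpow, one_mul]
  apply e2_cong3
  unfold kap
  push_cast
  rw [hM2]
  rw [show (m + 1 / 2 : ℂ) = (2 * m + 1) / 2 by ring]
  obtain ⟨D, hD⟩ : ∃ D, D = 2 * m + 1 := ⟨_, rfl⟩
  rw [← hD] at hm1 ⊢
  field_simp
  rw [hD]
  ring

theorem combine {C k : ℤ → ℂ} {K : ℤ → ℤ → ℂ} {a : ℂ} (hK : ∀ n, HasSum (K n) (k n))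
    (h : HasSum (fun x : ℤ × ℤ => C x.1 * K x.1 (x.1 + x.2)) a) :
    HasSum (fun n => C n * k n) a :=
  h.prod_fiberwise fun n => ((Equiv.addLeft n).hasSum_iff.2 (hK n)).mul_left (C n)

theorem kt_hasSum {τ z : ℂ} (hτ : 0 < τ.im) (hz : ∀ a b : ℤ, z ≠ (a : ℂ) + (b : ℂ) * τ) (S : ℤ) :
    HasSum (fun j => kt τ z S j)
      (-Complex.I * dedekindEta τ ^ 3 / theta11 τ z * e2 (((S : ℂ) + 1 / 2) * z)) := by
  rw [← kt_tsum hτ hz]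
  exact (kt_summable z hτ S).hasSum

theorem norm_hasSum {f : ℤ → ℂ} (c : ℂ) (h : Summable fun j => ‖f j‖) :
    HasSum (fun x : ℤ => f x * c) ((∑' j, f j) * c) :=
  h.of_norm.hasSum.mul_right c

theorem swap_hasSum {f : ℤ × ℤ → ℂ} {a : ℂ} (h : HasSum f a) :
    HasSum (fun x : ℤ × ℤ => f (x.2, x.1)) a := (Equiv.prodComm ℤ ℤ).hasSum_iff.2 h

theorem point {M : ℕ} {m : ℂ} (hM2 : (M : ℂ) = 2 * m) {S : ℤ} {s : ℂ} (hs : s = (S : ℂ) + 1 / 2)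
    (τ z₁ z₂ : ℂ) (j n : ℤ) :
    Xf m s τ z₁ z₂ j n / (1 - Yf τ z₁ j n) +
      Xf m s τ z₁ z₂ j n * ((Yf τ z₁ j n ^ (-(j * (M : ℤ))) - 1) / (1 - Yf τ z₁ j n)) =
    (-1) ^ n * e2 (kap m s τ (z₁ - z₂) + m * (n : ℂ) ^ 2 * τ + m * n * (z₁ + z₂) +
      ((n : ℂ) ^ 2 / 2 + s * n) * τ) * kt τ z₁ (S + n) (n + j) := by
  have h1 : ∀ a b c : ℂ, a / b + a * ((c - 1) / b) = a * c / b := by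
    intro a b c; rw [← mul_div_assoc, ← add_div]; congr 1; ring
  rw [h1]
  unfold kt Yf Xf
  rw [← mul_div_assoc]
  congr 1
  rw [← e2_int, zpow_add₀ (by norm_num : (-1 : ℂ) ≠ 0)]
  have hn : ((-1 : ℂ) ^ n) * (-1) ^ n = 1 := by rw [← mul_zpow]; norm_num
  have h2 : ∀ a b c d : ℂ, a + b = c + d → (-1) ^ j * e2 a * e2 b =
      (-1) ^ n * e2 c * ((-1) ^ n * (-1) ^ j * e2 d) := by
    intro a b c d h
    have h3 : e2 a * e2 b = e2 c * e2 d := by rw [← e2_add, ← e2_add, h]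
    linear_combination (-1) ^ j * h3 - (-1) ^ j * e2 c * e2 d * hn
  apply h2
  push_cast
  rw [hM2, hs]
  ring

theorem stmt_5 (M : ℕ) (hM : 0 < M) (m : ℂ) (hm : m = (M : ℂ) / 2)
    (S : ℤ) (s : ℂ) (hs : s = (S : ℂ) + 1 / 2)
    (τ : ℂ) (hτ : 0 < τ.im) (z₁ z₂ : ℂ)
    (hz : ∀ a b : ℤ, z₁ ≠ (a : ℂ) + (b : ℂ) * τ) :
    jtheta (-1) s (m + 1 / 2) τ (-(2 * m * (z₁ - z₂)) / (2 * m + 1)) * Phi1 1 m 0 τ z₁ z₂ +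
      e2 (-(m * s * (z₁ - z₂)) / (2 * m + 1)) *
        ∑ r ∈ Finset.range M,
          (indefSum fun j p => fcoef m s τ z₁ z₂ (-j) ((r : ℤ) - p * (M : ℤ))) *
            jtheta 1 (r : ℂ) m τ (z₁ + z₂) =
      -Complex.I * jtheta (-1) s (m + 1 / 2) τ (z₁ + z₂ + (z₁ - z₂) / (2 * m + 1)) *
        dedekindEta τ ^ 3 / theta11 τ z₁ := by
  have hM0 : (M : ℂ) ≠ 0 := by exact_mod_cast hM.ne'
  have hM1 : (M : ℂ) + 1 ≠ 0 := by exact_mod_cast (Nat.succ_ne_zero M)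
  have hM2 : (M : ℂ) = 2 * m := by rw [hm]; ring
  have hm0 : m ≠ 0 := by rw [hm]; exact div_ne_zero hM0 two_ne_zero
  have hm1 : 2 * m + 1 ≠ 0 := by rw [← hM2]; exact hM1
  have him : 0 < (m * τ).im := by
    have : m = ((M / 2 : ℝ) : ℂ) := by rw [hm]; push_cast; ring
    rw [this]; exact mul_tau_im hτ (by positivity)
  have him1 : 0 < ((m + 1 / 2) * τ).im := by
    have : m + 1 / 2 = ((M / 2 + 1 / 2 : ℝ) : ℂ) := by rw [hm]; push_cast; ring
    rw [this]; exact mul_tau_im hτ (by positivity)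
  have hn1 : ‖(-1 : ℂ)‖ = 1 := by simp
  have HC := (partA (z₁ := z₁) (z₂ := z₂) (s := s) hm1 hτ him him1).add
    (partB hM hm s hτ him z₁ z₂ hm0 hm1 hz)
  have HC2 := combine (C := fun n : ℤ => (-1) ^ n * e2 (kap m s τ (z₁ - z₂) +
      m * (n : ℂ) ^ 2 * τ + m * n * (z₁ + z₂) + ((n : ℂ) ^ 2 / 2 + s * n) * τ))
    (K := fun n j => kt τ z₁ (S + n) j)
    (k := fun n => -Complex.I * dedekindEta τ ^ 3 / theta11 τ z₁ *
      e2 ((((S + n : ℤ) : ℂ) + 1 / 2) * z₁))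
    (fun n => kt_hasSum hτ hz (S + n))
    (hasSum_of_eq' (swap_hasSum HC) (fun x => (point hM2 hs τ z₁ z₂ x.2 x.1).symm) rfl)
  have HR := norm_hasSum (-Complex.I * dedekindEta τ ^ 3 / theta11 τ z₁)
    (jtheta_summable hn1 s (m + 1 / 2) τ (z₁ + z₂ + (z₁ - z₂) / (2 * m + 1)) him1)
  refine (HC2.unique (hasSum_of_eq' HR (fun n => ?_) rfl)).trans ?_
  swap
  · unfold jtheta
    ring
  · have h : ∀ a b c g k : ℂ, a + b = c → g * e2 a * (k * e2 b) = g * e2 c * k := by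
      intro a b c g k h
      rw [← h, e2_add]; ring
    apply h
    unfold kap
    have hS : (S : ℂ) = s - 1 / 2 := by rw [hs]; ring
    push_cast
    rw [hS]
    rw [show (m + 1 / 2 : ℂ) = (2 * m + 1) / 2 by ring]
    obtain ⟨D, hD⟩ : ∃ D, D = 2 * m + 1 := ⟨_, rfl⟩
    rw [← hD] at hm1 ⊢
    field_simp
    rw [hD]
    ring
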